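/- Let n ≥ 2 be a natural number and let q be a real number with 0 < q < √(2/n). Then (C_H(n,q)/C_Y(n,q))^(1/(1+q)) < (1+q)⁴ / ( q^(q/(1+q)) (2+q) ). -/

import Mathlib

open Real

/-- `A(n,q) = 2/n - q²`. -/
noncomputable def ssyA (n : ℕ) (q : ℝ) : ℝ := 2 / n - q ^ 2

/-- The Young-closure constant `C_Y(n,q)`. -/
noncomputable def CY (n : ℕ) (q : ℝ) : ℝ :=
  (2 ^ (1 + q) * q ^ q / (1 + q) ^ (1 + q)) *
    ((2 + q) * (1 + 2 * (1 + q) / ssyA n q +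
      8 * (1 + q) * (q ^ 2 + 2 * q + 2) / (ssyA n q) ^ 2)) ^ (1 + q)

/-- The Hölder-closure constant `C_H(n,q)`. -/
noncomputable def CH (n : ℕ) (q : ℝ) : ℝ :=
  (2 * (1 + q) ^ 2 * (1 + 2 * (1 + q) ^ 2 / ssyA n q +
      8 * (1 + q) ^ 2 * (q ^ 2 + 2 * q + 2) / (ssyA n q) ^ 2)) ^ (1 + q)

theorem ratio_root_bound (n : ℕ) (hn : 2 ≤ n) (q : ℝ)
    (hq0 : 0 < q) (hqn : q < Real.sqrt (2 / n)) :
    (CH n q / CY n q) ^ (1 / (1 + q)) <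
      (1 + q) ^ 4 / (q ^ (q / (1 + q)) * (2 + q)) := by
  have hn' : (0:ℝ) < 2 / n := by
    have : (0:ℝ) < n := by exact_mod_cast (by omega : 0 < n)
    positivity
  have hA : 0 < ssyA n q := by
    unfold ssyA
    have := (Real.lt_sqrt hq0.le).1 hqn
    linarith
  have h1 : (0:ℝ) < 1 + q := by linarith
  have hr : 0 < q ^ (q / (1 + q)) := Real.rpow_pos_of_pos hq0 _
  have hqq : q ^ q = (q ^ (q / (1 + q))) ^ (1 + q) := by
    rw [← Real.rpow_mul hq0.le, div_mul_cancel₀ _ h1.ne']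
  unfold CH CY
  rw [hqq]
  generalize q ^ (q / (1 + q)) = r at *
  generalize ssyA n q = A at *
  have hY : 0 < 1 + 2 * (1 + q) / A + 8 * (1 + q) * (q ^ 2 + 2 * q + 2) / A ^ 2 := by positivity
  have hH : 0 < 1 + 2 * (1 + q) ^ 2 / A + 8 * (1 + q) ^ 2 * (q ^ 2 + 2 * q + 2) / A ^ 2 := by
    positivity
  have hHY : 1 + 2 * (1 + q) ^ 2 / A + 8 * (1 + q) ^ 2 * (q ^ 2 + 2 * q + 2) / A ^ 2
      < (1 + q) * (1 + 2 * (1 + q) / A + 8 * (1 + q) * (q ^ 2 + 2 * q + 2) / A ^ 2) := by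
    have : (1 + q) * (1 + 2 * (1 + q) / A + 8 * (1 + q) * (q ^ 2 + 2 * q + 2) / A ^ 2)
      = q + (1 + 2 * (1 + q) ^ 2 / A + 8 * (1 + q) ^ 2 * (q ^ 2 + 2 * q + 2) / A ^ 2) := by ring
    linarith
  generalize 1 + 2 * (1 + q) / A + 8 * (1 + q) * (q ^ 2 + 2 * q + 2) / A ^ 2 = Y at *
  generalize 1 + 2 * (1 + q) ^ 2 / A + 8 * (1 + q) ^ 2 * (q ^ 2 + 2 * q + 2) / A ^ 2 = H at *
  rw [← Real.mul_rpow (by norm_num) hr.le, ← Real.div_rpow (by positivity) h1.le,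
    ← Real.mul_rpow (by positivity) (by positivity),
    ← Real.div_rpow (by positivity) (by positivity), ← Real.rpow_mul (by positivity),
    mul_one_div_cancel h1.ne', Real.rpow_one]
  have e : 2 * (1 + q) ^ 2 * H / (2 * r / (1 + q) * ((2 + q) * Y))
      = ((1 + q) ^ 3 * (H / Y)) / (r * (2 + q)) := by
    field_simp
  rw [e]
  have hlt : H / Y < 1 + q := by rwa [div_lt_iff₀ hY]
  have h4 : (1 + q) ^ 4 = (1 + q) ^ 3 * (1 + q) := by ring
  rw [h4]
  gcongr
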